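/- Suppose an X-ray estimate holds at dimension d ∈ (2,3) with exponents α, β ∈ (0,1) and constant A₀. Then there is a constant A (depending only on d, α, β, A₀) such that for all 0 < δ ≤ σ ≤ θ ≤ c₀ (c₀ a small absolute constant) and every collection 𝕋_σ of essentially distinct σ-tubes whose directions all lie in a cap of radius θ, one has ‖Σ_{T_σ∈𝕋_σ} χ_{T_σ}‖_{L^{d'}(ℝ³)} ≤ A · σ^{(d−3)/d} · θ^{(d+1)/d} · m^{1−β}, where m is the directional multiplicity of 𝕋_σ at scale σ and d' = d/(d−1). -/

import Mathlib

open MeasureTheory Metric Set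
open scoped ENNReal NNReal RealInnerProductSpace

noncomputable section

abbrev R3 : Type := EuclideanSpace ℝ (Fin 3)

/-- A tube core: a line segment joining the planes {z = 0} and {z = 1},
with orientation within 1/10 of the vertical. -/
structure Tube where
  p0 : R3
  p1 : R3
  h0 : p0 2 = 0
  h1 : p1 2 = 1
  hx : |(p1 - p0) 0| ≤ 1/10
  hy : |(p1 - p0) 1| ≤ 1/10

/-- The direction of a tube: the difference of its endpoints. -/
def Tube.dir (T : Tube) : R3 := T.p1 - T.p0

/-- The σ-tube associated to a tube core: the σ-neighbourhood of the segment. -/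
def Tube.set (T : Tube) (σ : ℝ) : Set R3 :=
  Metric.thickening σ (segment ℝ T.p0 T.p1)

/-- A direction: a vector (x, y, 1) within 1/10 of the vertical. -/
def IsDirection (v : R3) : Prop := v 2 = 1 ∧ |v 0| ≤ 1/10 ∧ |v 1| ≤ 1/10

/-- Two σ-tubes are equivalent (with constant C): each lies in the C-dilate of the other. -/
def TubeEquiv (C σ : ℝ) (T T' : Tube) : Prop :=
  T.set σ ⊆ T'.set (C * σ) ∧ T'.set σ ⊆ T.set (C * σ)

/-- A collection of σ-tubes is essentially distinct (with constant C): each of its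
tubes is equivalent to at most C of the others. -/
def EssDistinct (C σ : ℝ) (𝕋 : Set Tube) : Prop :=
  𝕋.Finite ∧ ∀ T ∈ 𝕋, (({T' ∈ 𝕋 | T' ≠ T ∧ TubeEquiv C σ T T'}.ncard : ℝ)) ≤ C

/-- A δ-separated set. -/
def Separated (δ : ℝ) (E : Set R3) : Prop :=
  ∀ x ∈ E, ∀ y ∈ E, x ≠ y → δ ≤ dist x y

/-- The directional multiplicity of 𝕋 at scale σ is at most m: at most m of the
tubes have directions in any cap of radius σ. -/
def DirMultLE (σ : ℝ) (𝕋 : Set Tube) (m : ℝ) : Prop :=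
  ∀ ω : R3, (({T ∈ 𝕋 | dist T.dir ω ≤ σ}.ncard : ℝ)) ≤ m

/-- The multiplicity function ∑_{T ∈ 𝕋} χ_T of a collection of σ-tubes. -/
def tubeCount (σ : ℝ) (𝕋 : Set Tube) (x : R3) : ℝ :=
  (({T ∈ 𝕋 | x ∈ T.set σ}).ncard : ℝ)

/-- The L^p norm ‖∑_{T ∈ 𝕋} χ_T‖_{L^p(ℝ³)}. -/
def tubeNorm (σ p : ℝ) (𝕋 : Set Tube) : ℝ≥0∞ :=
  (∫⁻ x : R3, ENNReal.ofReal (tubeCount σ 𝕋 x ^ p)) ^ (1 / p)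

/-- An X-ray estimate at dimension d with exponents α, β and constant A₀:
for every 0 < δ < 1, every δ-separated set of directions 𝓔 and every collection 𝕋 of
essentially distinct δ-tubes pointing in directions in 𝓔,
‖∑_{T∈𝕋} χ_T‖_{d'} ≤ A₀ δ^{1-3/d} m^{1-β} (δ² #𝓔)^α where m bounds the directional
multiplicity of 𝕋 and d' = d/(d-1). -/
def XRayEstimate (Ceq d α β A₀ : ℝ) : Prop :=
  ∀ δ : ℝ, 0 < δ → δ < 1 →
    ∀ 𝓔 : Set R3, (∀ v ∈ 𝓔, IsDirection v) → Separated δ 𝓔 → 𝓔.Finite →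
      ∀ 𝕋 : Set Tube, EssDistinct Ceq δ 𝕋 → (∀ T ∈ 𝕋, T.dir ∈ 𝓔) →
        ∀ m : ℝ, DirMultLE δ 𝕋 m →
          tubeNorm δ (d / (d - 1)) 𝕋 ≤
            ENNReal.ofReal (A₀ * δ ^ (1 - 3 / d) * m ^ (1 - β) * (δ ^ 2 * 𝓔.ncard) ^ α)

/-- A Kakeya estimate at dimension d with exponent α and constant A₀ (the β = 0
case of the X-ray estimate). -/
def KakeyaEstimate (Ceq d α A₀ : ℝ) : Prop :=
  ∀ δ : ℝ, 0 < δ → δ < 1 →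
    ∀ 𝓔 : Set R3, (∀ v ∈ 𝓔, IsDirection v) → Separated δ 𝓔 → 𝓔.Finite →
      ∀ 𝕋 : Set Tube, EssDistinct Ceq δ 𝕋 → (∀ T ∈ 𝕋, T.dir ∈ 𝓔) →
        ∀ m : ℝ, DirMultLE δ 𝕋 m →
          tubeNorm δ (d / (d - 1)) 𝕋 ≤
            ENNReal.ofReal (A₀ * δ ^ (1 - 3 / d) * m * (δ ^ 2 * 𝓔.ncard) ^ α)

lemma Tube.dir_apply (T : Tube) (i : Fin 3) : T.dir i = T.p1 i - T.p0 i := by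
  simp [Tube.dir]

lemma Tube.dir_two (T : Tube) : T.dir 2 = 1 := by
  rw [T.dir_apply, T.h0, T.h1, sub_zero]

lemma Tube.abs_dir_zero_le (T : Tube) : |T.dir 0| ≤ 1 / 10 := T.hx

lemma Tube.abs_dir_one_le (T : Tube) : |T.dir 1| ≤ 1 / 10 := T.hy

lemma Tube.mem_set_iff (T : Tube) (σ : ℝ) (x : R3) :
    x ∈ T.set σ ↔ ∃ t ∈ Icc (0 : ℝ) 1, dist x (T.p0 + t • T.dir) < σ := by
  simp only [Tube.set, mem_thickening_iff, segment_eq_image', Tube.dir, mem_image,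
    exists_exists_and_eq_and]

lemma Tube.p0_mem_set (T : Tube) {σ : ℝ} (hσ : 0 < σ) : T.p0 ∈ T.set σ :=
  (T.mem_set_iff σ _).2 ⟨0, by simp, by simpa⟩

lemma Tube.p1_mem_set (T : Tube) {σ : ℝ} (hσ : 0 < σ) : T.p1 ∈ T.set σ :=
  (T.mem_set_iff σ _).2 ⟨1, by simp, by simpa [Tube.dir]⟩

lemma measurableSet_tube (T : Tube) (σ : ℝ) : MeasurableSet (T.set σ) :=
  isOpen_thickening.measurableSet

lemma Tube.set_mono (T : Tube) {σ τ : ℝ} (h : σ ≤ τ) : T.set σ ⊆ T.set τ :=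
  thickening_mono h _

lemma TubeEquiv.refl {C σ : ℝ} (hC : 1 ≤ C) (hσ : 0 < σ) (T : Tube) : TubeEquiv C σ T T :=
  have h := T.set_mono (le_mul_of_one_le_left hσ.le hC)
  ⟨h, h⟩

/-- A tube with prescribed horizontal starting point and horizontal direction. -/
def Tube.ofCoords (a b u v : ℝ) (hu : |u| ≤ 1 / 10) (hv : |v| ≤ 1 / 10) : Tube where
  p0 := !₂[a, b, 0]
  p1 := !₂[a + u, b + v, 1]
  h0 := by simp
  h1 := by simp
  hx := by simpa using hu
  hy := by simpa using hv

lemma abs_apply_sub_le_dist (x y : R3) (i : Fin 3) : |x i - y i| ≤ dist x y := by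
  rw [dist_eq_norm]
  simpa using PiLp.norm_apply_le (x - y) i

lemma norm_lt_of_sq {x : R3} {r : ℝ} (hr : 0 < r) (h : x 0 ^ 2 + x 1 ^ 2 + x 2 ^ 2 < r ^ 2) :
    ‖x‖ < r := by
  refine lt_of_pow_lt_pow_left₀ 2 hr.le ?_
  rw [EuclideanSpace.norm_sq_eq, Fin.sum_univ_three]
  simpa using h

lemma norm_le_of_sq {x : R3} {r : ℝ} (hr : 0 ≤ r) (h : x 0 ^ 2 + x 1 ^ 2 + x 2 ^ 2 ≤ r ^ 2) :
    ‖x‖ ≤ r := by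
  refine le_of_sq_le_sq ?_ hr
  rw [EuclideanSpace.norm_sq_eq, Fin.sum_univ_three]
  simpa using h

lemma sq_sum_lt_of_norm_lt {x : R3} {r : ℝ} (h : ‖x‖ < r) :
    x 0 ^ 2 + x 1 ^ 2 + x 2 ^ 2 < r ^ 2 := by
  have := pow_lt_pow_left₀ h (norm_nonneg x) two_ne_zero
  rw [EuclideanSpace.norm_sq_eq, Fin.sum_univ_three] at this
  simpa using this

/-- The endpoints and directions of equivalent tubes agree up to the width of the tubes. -/
lemma Tube.abs_sub_le_of_subset {S S' : Tube} {C s : ℝ} (hs : 0 < s)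
    (h : S.set s ⊆ S'.set (C * s)) (i : Fin 3) (hi : |S'.dir i| ≤ 1 / 10) :
    |S.p0 i - S'.p0 i| ≤ 2 * (C * s) ∧ |S.dir i - S'.dir i| ≤ 4 * (C * s) := by
  obtain ⟨t, ht, hd⟩ := (S'.mem_set_iff _ _).1 (h (S.p0_mem_set hs))
  obtain ⟨u, hu, he⟩ := (S'.mem_set_iff _ _).1 (h (S.p1_mem_set hs))
  have hd2 := (abs_apply_sub_le_dist _ _ 2).trans hd.le
  have he2 := (abs_apply_sub_le_dist _ _ 2).trans he.le
  have hdi := (abs_apply_sub_le_dist _ _ i).trans hd.le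
  have hei := (abs_apply_sub_le_dist _ _ i).trans he.le
  simp only [PiLp.add_apply, PiLp.smul_apply, smul_eq_mul, S'.dir_two, S.h0, S'.h0, S.h1] at *
  have hS := S.dir_apply i
  rw [abs_le] at *
  have ht1 : t * S'.dir i ≤ C * s := by nlinarith [ht.1, ht.2]
  have ht2 : -(C * s) ≤ t * S'.dir i := by nlinarith [ht.1, ht.2]
  have hu1 : (1 - u) * S'.dir i ≤ C * s := by nlinarith [hu.1, hu.2]
  have hu2 : -(C * s) ≤ (1 - u) * S'.dir i := by nlinarith [hu.1, hu.2]
  rw [abs_le]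
  constructor <;> constructor <;> linarith

/-- Tubes whose coordinates are close are contained in dilates of each other. -/
lemma Tube.set_subset_of_close {T T' : Tube} {C σ η : ℝ} (hσ : 0 < σ) (hη : 0 < η)
    (hC : 3 * η ≤ C - 1)
    (hp0 : |T.p0 0 - T'.p0 0| ≤ η * σ) (hp1 : |T.p0 1 - T'.p0 1| ≤ η * σ)
    (hd0 : |T.dir 0 - T'.dir 0| ≤ η * σ) (hd1 : |T.dir 1 - T'.dir 1| ≤ η * σ) :
    T.set σ ⊆ T'.set (C * σ) := by
  intro x hx
  obtain ⟨t, ht, hd⟩ := (T.mem_set_iff _ _).1 hx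
  refine (T'.mem_set_iff _ _).2 ⟨t, ht, ?_⟩
  have hησ : 0 < η * σ := mul_pos hη hσ
  have key : dist (T.p0 + t • T.dir) (T'.p0 + t • T'.dir) ≤ 3 * (η * σ) := by
    rw [dist_eq_norm]
    refine norm_le_of_sq (by positivity) ?_
    simp only [PiLp.add_apply, PiLp.smul_apply, PiLp.sub_apply, smul_eq_mul, T.dir_two,
      T'.dir_two, T.h0, T'.h0]
    have aux : ∀ a b c d : ℝ, |a - c| ≤ η * σ → |b - d| ≤ η * σ →
        (a + t * b - (c + t * d)) ^ 2 ≤ (2 * (η * σ)) ^ 2 := by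
      intro a b c d h1 h2
      refine sq_le_sq' ?_ ?_ <;> rw [abs_le] at h1 h2 <;> nlinarith [ht.1, ht.2]
    nlinarith [aux _ _ _ _ hp0 hd0, aux _ _ _ _ hp1 hd1]
  calc dist x (T'.p0 + t • T'.dir)
      ≤ dist x (T.p0 + t • T.dir) + dist (T.p0 + t • T.dir) (T'.p0 + t • T'.dir) :=
        dist_triangle _ _ _
    _ < σ + 3 * (η * σ) := add_lt_add_of_lt_of_le hd key
    _ ≤ C * σ := by nlinarith

lemma Tube.dist_dir_le {T T' : Tube} {r : ℝ}
    (hd0 : |T.dir 0 - T'.dir 0| ≤ 1 / 2 * r) (hd1 : |T.dir 1 - T'.dir 1| ≤ 1 / 2 * r) :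
    dist T.dir T'.dir ≤ r := by
  have hr : 0 ≤ 1 / 2 * r := (abs_nonneg _).trans hd0
  rw [dist_eq_norm]
  refine norm_le_of_sq (by linarith) ?_
  simp only [PiLp.sub_apply, T.dir_two, T'.dir_two]
  nlinarith [sq_le_sq' (abs_le.1 hd0).1 (abs_le.1 hd0).2,
    sq_le_sq' (abs_le.1 hd1).1 (abs_le.1 hd1).2]

/-- The linear map which blows the cap of radius `R` about `(a, b, 1)` up to unit size. -/
def capBlowup (a b R : ℝ) : R3 →ₗ[ℝ] R3 :=
  Matrix.toEuclideanLin !![R⁻¹, 0, -a * R⁻¹; 0, R⁻¹, -b * R⁻¹; 0, 0, 1]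

lemma capBlowup_apply_zero (a b R : ℝ) (x : R3) :
    capBlowup a b R x 0 = (x 0 - a * x 2) / R := by
  simp [capBlowup, Matrix.toLpLin_apply, dotProduct, Fin.sum_univ_three]
  ring

lemma capBlowup_apply_one (a b R : ℝ) (x : R3) :
    capBlowup a b R x 1 = (x 1 - b * x 2) / R := by
  simp [capBlowup, Matrix.toLpLin_apply, dotProduct, Fin.sum_univ_three]
  ring

lemma capBlowup_apply_two (a b R : ℝ) (x : R3) : capBlowup a b R x 2 = x 2 := by
  simp [capBlowup, Matrix.toLpLin_apply, dotProduct, Fin.sum_univ_three]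

lemma det_capBlowup (a b R : ℝ) : LinearMap.det (capBlowup a b R) = (R ^ 2)⁻¹ := by
  rw [capBlowup, Matrix.toEuclideanLin_eq_toLin_orthonormal, LinearMap.det_toLin]
  simp [Matrix.det_fin_three]
  ring

/-- `S` is obtained from `T` by blowing up the cap of radius `R` about `(a, b, 1)` and rounding
the direction to the grid of side `s`. -/
structure IsSnap (a b R s : ℝ) (T S : Tube) : Prop where
  p0_zero : S.p0 0 = T.p0 0 / R
  p0_one : S.p0 1 = T.p0 1 / R
  grid_zero : ∃ i : ℤ, S.dir 0 = i * s
  grid_one : ∃ i : ℤ, S.dir 1 = i * s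
  dir_zero : |S.dir 0 - (T.dir 0 - a) / R| ≤ s / 2
  dir_one : |S.dir 1 - (T.dir 1 - b) / R| ≤ s / 2

lemma exists_grid_approx {s : ℝ} (hs : 0 < s) (x : ℝ) : ∃ i : ℤ, |i * s - x| ≤ s / 2 := by
  refine ⟨round (x / s), ?_⟩
  have h := abs_sub_round (x / s)
  have : (round (x / s) : ℝ) * s - x = -((x / s - round (x / s)) * s) := by
    field_simp; ring
  rw [this, abs_neg, abs_mul, abs_of_pos hs]
  nlinarith

lemma exists_isSnap {a b R s : ℝ} (hs : 0 < s) (hs' : s ≤ 12 / 100) (T : Tube)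
    (ha : |(T.dir 0 - a) / R| ≤ 1 / 100) (hb : |(T.dir 1 - b) / R| ≤ 1 / 100) :
    ∃ S : Tube, IsSnap a b R s T S := by
  obtain ⟨i, hi⟩ := exists_grid_approx hs ((T.dir 0 - a) / R)
  obtain ⟨j, hj⟩ := exists_grid_approx hs ((T.dir 1 - b) / R)
  have hi' : |i * s| ≤ 1 / 10 := by rw [abs_le] at *; constructor <;> linarith
  have hj' : |j * s| ≤ 1 / 10 := by rw [abs_le] at *; constructor <;> linarith
  refine ⟨Tube.ofCoords (T.p0 0 / R) (T.p0 1 / R) (i * s) (j * s) hi' hj', ?_⟩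
  constructor
  · simp [Tube.ofCoords]
  · simp [Tube.ofCoords]
  · exact ⟨i, by simp [Tube.ofCoords, Tube.dir]⟩
  · exact ⟨j, by simp [Tube.ofCoords, Tube.dir]⟩
  · simpa [Tube.ofCoords, Tube.dir] using hi
  · simpa [Tube.ofCoords, Tube.dir] using hj

lemma IsSnap.capBlowup_mem {a b R σ : ℝ} {T S : Tube} (hR : 0 < R) (hR1 : R ≤ 1) (hσ : 0 < σ)
    (ha : |a| ≤ 1 / 5) (hb : |b| ≤ 1 / 5) (h : IsSnap a b R (12 * σ / R) T S) {x : R3}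
    (hx : x ∈ T.set σ) : capBlowup a b R x ∈ S.set (12 * σ / R) := by
  obtain ⟨t, ht, hd⟩ := (T.mem_set_iff _ _).1 hx
  refine (S.mem_set_iff _ _).2 ⟨t, ht, ?_⟩
  set q := T.p0 + t • T.dir with hq
  set s := 12 * σ / R with hs
  have hs0 : 0 < s := by positivity
  have h1 : ‖capBlowup a b R (x - q)‖ < s / 4 := by
    refine norm_lt_of_sq (by positivity) ?_
    rw [capBlowup_apply_zero, capBlowup_apply_one, capBlowup_apply_two]
    have hu := sq_sum_lt_of_norm_lt (by rwa [dist_eq_norm] at hd : ‖x - q‖ < σ)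
    set u := x - q
    have e : s / 4 = 3 * σ / R := by rw [hs]; ring
    have ha2 : a ^ 2 ≤ 1 := by rw [abs_le] at ha; nlinarith
    have hb2 : b ^ 2 ≤ 1 := by rw [abs_le] at hb; nlinarith
    have hR2 : R ^ 2 ≤ 1 := by nlinarith
    have e1 : (u 0 - a * u 2) ^ 2 ≤ 2 * u 0 ^ 2 + 2 * u 2 ^ 2 := by
      nlinarith [sq_nonneg (u 0 + a * u 2), mul_le_mul_of_nonneg_right ha2 (sq_nonneg (u 2))]
    have e2 : (u 1 - b * u 2) ^ 2 ≤ 2 * u 1 ^ 2 + 2 * u 2 ^ 2 := by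
      nlinarith [sq_nonneg (u 1 + b * u 2), mul_le_mul_of_nonneg_right hb2 (sq_nonneg (u 2))]
    have e3 := mul_le_mul_of_nonneg_right hR2 (sq_nonneg (u 2))
    rw [e, div_pow, div_pow, div_pow, ← add_div, lt_div_iff₀ (by positivity), add_mul,
      div_mul_cancel₀ _ (by positivity)]
    nlinarith [sq_nonneg (u 0), sq_nonneg (u 1), sq_nonneg (u 2)]
  have h2 : ‖capBlowup a b R q - (S.p0 + t • S.dir)‖ ≤ s * (3 / 4) := by
    refine norm_le_of_sq (by positivity) ?_
    have q2 : q 2 = t := by simp [hq, T.h0, T.dir_two]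
    have q0 : q 0 = T.p0 0 + t * T.dir 0 := by simp [hq]
    have q1 : q 1 = T.p0 1 + t * T.dir 1 := by simp [hq]
    simp only [PiLp.add_apply, PiLp.smul_apply, PiLp.sub_apply, smul_eq_mul, S.dir_two,
      S.h0, capBlowup_apply_zero, capBlowup_apply_one, capBlowup_apply_two, q2, q0, q1,
      h.p0_zero, h.p0_one]
    have aux : ∀ p e a f : ℝ, |f - (e - a) / R| ≤ s / 2 →
        ((p + t * e - a * t) / R - (p / R + t * f)) ^ 2 ≤ (s / 2) ^ 2 := by
      intro p e a f h
      have : (p + t * e - a * t) / R - (p / R + t * f) = - (t * (f - (e - a) / R)) := by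
        field_simp; ring
      rw [this]
      rw [abs_le] at h
      refine sq_le_sq' ?_ ?_ <;> nlinarith [ht.1, ht.2]
    nlinarith [aux (T.p0 0) _ _ _ h.dir_zero, aux (T.p0 1) _ _ _ h.dir_one]
  have : capBlowup a b R x - (S.p0 + t • S.dir)
      = capBlowup a b R (x - q) + (capBlowup a b R q - (S.p0 + t • S.dir)) := by
    rw [map_sub]; abel
  rw [dist_eq_norm, this]
  linarith [norm_add_le (capBlowup a b R (x - q)) (capBlowup a b R q - (S.p0 + t • S.dir))]

/-- The starting points and the directions of two tubes agree up to `r` in each coordinate. -/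
def CoordClose (r : ℝ) (T T' : Tube) : Prop :=
  (|T.p0 0 - T'.p0 0| ≤ r ∧ |T.p0 1 - T'.p0 1| ≤ r) ∧
    |T.dir 0 - T'.dir 0| ≤ r ∧ |T.dir 1 - T'.dir 1| ≤ r

lemma CoordClose.symm {r : ℝ} {T T' : Tube} (h : CoordClose r T T') : CoordClose r T' T := by
  unfold CoordClose at *
  simpa only [abs_sub_comm] using h

lemma CoordClose.tubeEquiv {T T' : Tube} {C σ η : ℝ} (hσ : 0 < σ) (hη : 0 < η)
    (hC : 3 * η ≤ C - 1) (h : CoordClose (η * σ) T T') : TubeEquiv C σ T T' :=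
  ⟨Tube.set_subset_of_close hσ hη hC h.1.1 h.1.2 h.2.1 h.2.2,
    Tube.set_subset_of_close hσ hη hC h.symm.1.1 h.symm.1.2 h.symm.2.1 h.symm.2.2⟩

lemma abs_sub_le_of_div {x y R r : ℝ} (hR : 0 < R) (h : |x / R - y / R| ≤ r) :
    |x - y| ≤ r * R := by
  rwa [← sub_div, abs_div, abs_of_pos hR, div_le_iff₀ hR] at h

/-- Rounding to a grid of side `s` moves a rescaled number by at most `s / 2`. -/
lemma abs_sub_le_of_round {x y a u v R r s : ℝ} (hR : 0 < R) (hx : |u - (x - a) / R| ≤ s / 2)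
    (hy : |v - (y - a) / R| ≤ s / 2) (h : |u - v| ≤ r) : |x - y| ≤ (r + s) * R := by
  have : |(x - a) / R - (y - a) / R| ≤ r + s := by
    rw [abs_le] at *
    constructor <;> linarith
  simpa using abs_sub_le_of_div hR this

lemma IsSnap.dir_close {a b R s r : ℝ} {T T' S S' : Tube} (hR : 0 < R)
    (h : IsSnap a b R s T S) (h' : IsSnap a b R s T' S')
    (h0 : |S.dir 0 - S'.dir 0| ≤ r) (h1 : |S.dir 1 - S'.dir 1| ≤ r) :
    |T.dir 0 - T'.dir 0| ≤ (r + s) * R ∧ |T.dir 1 - T'.dir 1| ≤ (r + s) * R :=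
  ⟨abs_sub_le_of_round hR h.dir_zero h'.dir_zero h0,
    abs_sub_le_of_round hR h.dir_one h'.dir_one h1⟩

lemma IsSnap.coordClose {a b R C σ : ℝ} {T T' S S' : Tube} (hR : 0 < R) (hσ : 0 < σ)
    (hC : 1 ≤ C) (h : IsSnap a b R (12 * σ / R) T S) (h' : IsSnap a b R (12 * σ / R) T' S')
    (he : TubeEquiv C (12 * σ / R) S S') : CoordClose (60 * C * σ) T T' := by
  have hs : 0 < 12 * σ / R := by positivity
  have hC0 : C * (12 * σ / R) * R = 12 * C * σ := by field_simp
  have hs0 : 12 * σ / R * R = 12 * σ := by field_simp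
  have hCσ : σ ≤ C * σ := le_mul_of_one_le_left hσ.le hC
  obtain ⟨p0, d0⟩ := Tube.abs_sub_le_of_subset hs he.1 0 S'.abs_dir_zero_le
  obtain ⟨p1, d1⟩ := Tube.abs_sub_le_of_subset hs he.1 1 S'.abs_dir_one_le
  rw [h.p0_zero, h'.p0_zero] at p0
  rw [h.p0_one, h'.p0_one] at p1
  obtain ⟨e0, e1⟩ := h.dir_close hR h' d0 d1
  have p0 := abs_sub_le_of_div hR p0
  have p1 := abs_sub_le_of_div hR p1
  refine ⟨⟨?_, ?_⟩, ?_, ?_⟩ <;> nlinarith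

lemma tubeNorm_eq_eLpNorm {p : ℝ} (hp : 0 < p) (σ : ℝ) (𝕋 : Set Tube) :
    tubeNorm σ p 𝕋 = eLpNorm (tubeCount σ 𝕋) (ENNReal.ofReal p) volume := by
  rw [eLpNorm_eq_lintegral_rpow_enorm_toReal (by simpa) ENNReal.ofReal_ne_top,
    ENNReal.toReal_ofReal hp.le, tubeNorm]
  congr 1
  refine lintegral_congr fun x => ?_
  have h0 : 0 ≤ tubeCount σ 𝕋 x := Nat.cast_nonneg _
  rw [Real.enorm_eq_ofReal h0, ENNReal.ofReal_rpow_of_nonneg h0 hp.le]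

lemma measurable_tubeCount (σ : ℝ) {𝕋 : Set Tube} (h : 𝕋.Finite) :
    Measurable (tubeCount σ 𝕋) := by
  classical
  have : tubeCount σ 𝕋 = fun x => ∑ T ∈ h.toFinset, (T.set σ).indicator (fun _ => (1 : ℝ)) x := by
    funext x
    simp only [indicator_apply, Finset.sum_boole, tubeCount]
    rw [← ncard_coe_finset]
    congr 2
    ext T
    simp
  rw [this]
  exact Finset.measurable_fun_sum _ fun T _ =>
    measurable_const.indicator (measurableSet_tube T σ)

/-- Change of variables in an `L^p` norm under `capBlowup`. -/
lemma eLpNorm_comp_capBlowup {p : ℝ} (hp : 0 < p) (a b : ℝ) {R : ℝ} (hR : 0 < R) {g : R3 → ℝ}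
    (hg : Measurable g) :
    eLpNorm (fun x => g (capBlowup a b R x)) (ENNReal.ofReal p) volume
      = ENNReal.ofReal (R ^ (2 / p)) * eLpNorm g (ENNReal.ofReal p) volume := by
  have hdet : LinearMap.det (capBlowup a b R) ≠ 0 := by
    rw [det_capBlowup]; positivity
  have hmap := Measure.map_linearMap_addHaar_eq_smul_addHaar (volume : Measure R3) hdet
  have hΦ : Measurable (capBlowup a b R) :=
    (LinearMap.continuous_of_finiteDimensional _).measurable
  have := eLpNorm_map_measure (p := ENNReal.ofReal p) (μ := (volume : Measure R3)) (g := g)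
    hg.aestronglyMeasurable hΦ.aemeasurable
  rw [hmap, eLpNorm_smul_measure_of_ne_top ENNReal.ofReal_ne_top, det_capBlowup, inv_inv,
    abs_of_pos (by positivity), smul_eq_mul] at this
  rw [show (fun x => g (capBlowup a b R x)) = g ∘ capBlowup a b R from rfl, ← this,
    ENNReal.ofReal_rpow_of_nonneg (by positivity) (by positivity), ← Real.rpow_natCast,
    ← Real.rpow_mul hR.le]
  simp [hp.le, div_eq_mul_inv]

/-- Directions in the grid of side `s`. -/
def gridDirections (s : ℝ) : Set R3 :=
  {v | IsDirection v ∧ (∃ i : ℤ, v 0 = i * s) ∧ ∃ j : ℤ, v 1 = j * s}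

lemma grid_dist {s : ℝ} (hs : 0 < s) {i j : ℤ} (h : i ≠ j) : s ≤ |(i * s : ℝ) - j * s| := by
  rw [← sub_mul, abs_mul, abs_of_pos hs]
  refine le_mul_of_one_le_left hs.le ?_
  exact_mod_cast Int.one_le_abs (sub_ne_zero.2 h)

lemma gridDirections_separated {s : ℝ} (hs : 0 < s) : Separated s (gridDirections s) := by
  rintro x ⟨hx, ⟨i, hi⟩, j, hj⟩ y ⟨hy, ⟨i', hi'⟩, j', hj'⟩ hxy
  by_cases h : i = i'
  · by_cases h' : j = j'
    · refine absurd ?_ hxy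
      ext k
      fin_cases k
      · simp [hi, hi', h]
      · simp [hj, hj', h']
      · exact hx.1.trans hy.1.symm
    · have := abs_apply_sub_le_dist x y 1
      rw [hj, hj'] at this
      exact (grid_dist hs h').trans this
  · have := abs_apply_sub_le_dist x y 0
    rw [hi, hi'] at this
    exact (grid_dist hs h).trans this

lemma gridDirections_finite_card {s : ℝ} (hs : 0 < s) (hs1 : s ≤ 1) :
    (gridDirections s).Finite ∧ s ^ 2 * (gridDirections s).ncard ≤ 4 := by
  set M : ℕ := ⌊1 / 10 / s⌋₊ with hM
  have hMs : M * s ≤ 1 / 10 := by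
    have := Nat.floor_le (a := 1 / 10 / s) (by positivity)
    rwa [le_div_iff₀ hs] at this
  have hsub : gridDirections s ⊆ (fun k : ℤ × ℤ => (!₂[k.1 * s, k.2 * s, 1] : R3)) ''
      ↑((Finset.Icc (-(M : ℤ)) M) ×ˢ (Finset.Icc (-(M : ℤ)) M)) := by
    have key : ∀ (i : ℤ), |(i * s : ℝ)| ≤ 1 / 10 → i ∈ Finset.Icc (-(M : ℤ)) M := by
      intro i hi
      rw [abs_mul, abs_of_pos hs, ← le_div_iff₀ hs] at hi
      have : i.natAbs ≤ M := by
        rw [hM]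
        refine Nat.le_floor ?_
        rwa [Nat.cast_natAbs, Int.cast_abs]
      rw [Finset.mem_Icc]
      omega
    rintro x ⟨hx, ⟨i, hi⟩, j, hj⟩
    refine ⟨(i, j), ?_, ?_⟩
    · rw [Finset.mem_coe, Finset.mem_product]
      exact ⟨key i (hi ▸ hx.2.1), key j (hj ▸ hx.2.2)⟩
    · ext k
      fin_cases k
      · simp [hi]
      · simp [hj]
      · simp [hx.1]
  have hfin := (Finset.finite_toSet ((Finset.Icc (-(M : ℤ)) M) ×ˢ (Finset.Icc (-(M : ℤ)) M)))
  refine ⟨(hfin.image _).subset hsub, ?_⟩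
  have hcard := (ncard_le_ncard hsub (hfin.image _)).trans (ncard_image_le hfin)
  rw [ncard_coe_finset, Finset.card_product, Int.card_Icc] at hcard
  have e : ((M : ℤ) + 1 - -(M : ℤ)).toNat = 2 * M + 1 := by omega
  rw [e] at hcard
  have hcard' : ((gridDirections s).ncard : ℝ) ≤ (2 * M + 1) * (2 * M + 1) := by
    exact_mod_cast hcard
  have h0 : 0 ≤ M * s := by positivity
  calc s ^ 2 * ((gridDirections s).ncard : ℝ) ≤ s ^ 2 * ((2 * M + 1) * (2 * M + 1)) := by gcongr
    _ = (2 * (M * s) + s) ^ 2 := by ring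
    _ ≤ 2 ^ 2 := by gcongr; linarith
    _ = 4 := by norm_num

lemma DirMultLE.nonneg {σ m : ℝ} {𝕋 : Set Tube} (h : DirMultLE σ 𝕋 m) : 0 ≤ m :=
  (Nat.cast_nonneg _).trans (h 0)

/-- The rescaled estimate for a collection of tubes with well separated clusters. -/
lemma tubeNorm_le_of_clustered {Ceq d α β A₀ : ℝ} (hCeq : 1 ≤ Ceq) (hd2 : 2 < d)
    (hα : 0 < α) (hA₀ : 0 < A₀) (hX : XRayEstimate Ceq d α β A₀)
    {η σ R a b m : ℝ} {𝕌 : Set Tube} (hη : 0 < η) (hη2 : η ≤ 1 / 2) (hηC : 3 * η ≤ Ceq - 1)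
    (hσ : 0 < σ) (hR : 0 < R) (hR1 : R ≤ 1) (hσR : σ ≤ R / 100)
    (ha : |a| ≤ 1 / 5) (hb : |b| ≤ 1 / 5)
    (hdir : ∀ T ∈ 𝕌, |(T.dir 0 - a) / R| ≤ 1 / 100 ∧ |(T.dir 1 - b) / R| ≤ 1 / 100)
    (hU : EssDistinct Ceq σ 𝕌) (hm : DirMultLE σ 𝕌 m)
    (hclose : ∀ T ∈ 𝕌, ∀ T' ∈ 𝕌, CoordClose (60 * Ceq * σ) T T' → CoordClose (η * σ) T T')
    (hdirclose : ∀ T ∈ 𝕌, ∀ T' ∈ 𝕌,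
      |T.dir 0 - T'.dir 0| ≤ 60 * Ceq * σ → |T.dir 1 - T'.dir 1| ≤ 60 * Ceq * σ →
      |T.dir 0 - T'.dir 0| ≤ η * σ ∧ |T.dir 1 - T'.dir 1| ≤ η * σ) :
    tubeNorm σ (d / (d - 1)) 𝕌 ≤ ENNReal.ofReal ((Ceq + 1) * R ^ (2 / (d / (d - 1))) *
      (A₀ * (12 * σ / R) ^ (1 - 3 / d) * m ^ (1 - β) * 4 ^ α)) := by
  classical
  have hp : 0 < d / (d - 1) := div_pos (by linarith) (by linarith)
  set p := d / (d - 1)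
  set s := 12 * σ / R with hsdef
  have hs : 0 < s := by positivity
  have hs1 : s ≤ 12 / 100 := by
    rw [hsdef, div_le_iff₀ hR]; linarith
  have hsR : s * R = 12 * σ := by rw [hsdef]; field_simp
  have hm0 : 0 ≤ m := hm.nonneg
  have hCσ : σ ≤ Ceq * σ := le_mul_of_one_le_left hσ.le hCeq
  have hex : ∀ T : Tube, ∃ S : Tube, T ∈ 𝕌 → IsSnap a b R s T S := by
    intro T
    by_cases hT : T ∈ 𝕌
    · obtain ⟨S, hS⟩ := exists_isSnap (a := a) (b := b) (R := R) hs hs1 T (hdir T hT).1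
        (hdir T hT).2
      exact ⟨S, fun _ => hS⟩
    · exact ⟨T, fun h => absurd h hT⟩
  choose f hf using hex
  have hfin := hU.1
  have hEquiv : ∀ T ∈ 𝕌, ∀ T' ∈ 𝕌, TubeEquiv Ceq s (f T) (f T') → TubeEquiv Ceq σ T T' := by
    intro T hT T' hT' h
    have h1 := (hf T hT).coordClose hR hσ hCeq (hf T' hT') h
    exact (hclose T hT T' hT' h1).tubeEquiv hσ hη hηC
  have hSfin : (f '' 𝕌).Finite := hfin.image f
  have hSdist : EssDistinct Ceq s (f '' 𝕌) := by
    refine ⟨hSfin, ?_⟩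
    rintro _ ⟨T, hT, rfl⟩
    refine le_trans ?_ (hU.2 T hT)
    have hF : {T' ∈ 𝕌 | T' ≠ T ∧ TubeEquiv Ceq σ T T'}.Finite := hfin.subset fun _ h => h.1
    refine Nat.cast_le.2 (le_trans (ncard_le_ncard ?_ (hF.image f)) (ncard_image_le hF))
    rintro _ ⟨⟨T', hT', rfl⟩, hne, he⟩
    exact ⟨T', ⟨hT', fun h => hne (h ▸ rfl), hEquiv T hT T' hT' he⟩, rfl⟩
  have hSmult : DirMultLE s (f '' 𝕌) m := by
    intro ω
    rcases eq_empty_or_nonempty {S ∈ f '' 𝕌 | dist S.dir ω ≤ s} with h | ⟨_, ⟨T, hT, rfl⟩, hTω⟩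
    · rw [h, ncard_empty, Nat.cast_zero]; exact hm0
    · refine le_trans ?_ (hm T.dir)
      have hF : {T' ∈ 𝕌 | dist T'.dir T.dir ≤ σ}.Finite := hfin.subset fun _ h => h.1
      refine Nat.cast_le.2 (le_trans (ncard_le_ncard ?_ (hF.image f)) (ncard_image_le hF))
      rintro _ ⟨⟨T', hT', rfl⟩, hd⟩
      refine ⟨T', ⟨hT', ?_⟩, rfl⟩
      have hdd : dist (f T').dir (f T).dir ≤ 2 * s := by
        linarith [dist_triangle_right (f T').dir (f T).dir ω]
      obtain ⟨h0, h1⟩ := (hf T' hT').dir_close hR (hf T hT)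
        ((abs_apply_sub_le_dist _ _ 0).trans hdd) ((abs_apply_sub_le_dist _ _ 1).trans hdd)
      obtain ⟨k0, k1⟩ := hdirclose T' hT' T hT (h0.trans (by nlinarith))
        (h1.trans (by nlinarith))
      exact Tube.dist_dir_le (k0.trans (by gcongr)) (k1.trans (by gcongr))
  have hSdir : ∀ S ∈ f '' 𝕌, S.dir ∈ gridDirections s := by
    rintro _ ⟨T, hT, rfl⟩
    exact ⟨⟨(f T).dir_two, (f T).abs_dir_zero_le, (f T).abs_dir_one_le⟩, (hf T hT).grid_zero,
      (hf T hT).grid_one⟩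
  obtain ⟨hgfin, hgcard⟩ := gridDirections_finite_card hs (by linarith)
  have hmain := hX s hs (by linarith) (gridDirections s) (fun v hv => hv.1)
    (gridDirections_separated hs) hgfin _ hSdist hSdir m hSmult
  have hcount : ∀ x, tubeCount σ 𝕌 x ≤ (Ceq + 1) * tubeCount s (f '' 𝕌) (capBlowup a b R x) := by
    intro x
    have hAfin : {T ∈ 𝕌 | x ∈ T.set σ}.Finite := hfin.subset fun _ h => h.1
    set A := hAfin.toFinset with hA
    have hfib : ∀ S ∈ Finset.image f A, {T ∈ A | f T = S}.card ≤ ⌊Ceq + 1⌋₊ := by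
      intro S hS
      obtain ⟨T, hTA, rfl⟩ := Finset.mem_image.1 hS
      have hT : T ∈ 𝕌 := ((hAfin.mem_toFinset).1 hTA).1
      refine Nat.le_floor ?_
      have hF : {T' ∈ 𝕌 | T' ≠ T ∧ TubeEquiv Ceq σ T T'}.Finite := hfin.subset fun _ h => h.1
      have hsub : (({T' ∈ A | f T' = f T} : Finset Tube) : Set Tube) ⊆
          insert T {T' ∈ 𝕌 | T' ≠ T ∧ TubeEquiv Ceq σ T T'} := by
        intro T' hT'
        obtain ⟨hT'A, he⟩ := Finset.mem_filter.1 (Finset.mem_coe.1 hT')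
        have hT'U : T' ∈ 𝕌 := ((hAfin.mem_toFinset).1 hT'A).1
        by_cases h : T' = T
        · exact Or.inl h
        · exact Or.inr ⟨hT'U, h, hEquiv T hT T' hT'U (he ▸ TubeEquiv.refl hCeq hs _)⟩
      have h1 := (ncard_le_ncard hsub (hF.insert T)).trans (ncard_insert_le _ _)
      rw [ncard_coe_finset] at h1
      have h2 := hU.2 T hT
      have h3 : (({T' ∈ A | f T' = f T} : Finset Tube).card : ℝ) ≤
          ({T' ∈ 𝕌 | T' ≠ T ∧ TubeEquiv Ceq σ T T'}.ncard : ℝ) + 1 := by exact_mod_cast h1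
      linarith
    have h1 := Finset.card_le_mul_card_image A _ hfib
    have h2 : (Finset.image f A).card ≤
        {S ∈ f '' 𝕌 | capBlowup a b R x ∈ S.set s}.ncard := by
      rw [← ncard_coe_finset]
      refine ncard_le_ncard ?_ (hSfin.subset fun _ h => h.1)
      intro S hS
      obtain ⟨T, hTA, rfl⟩ := Finset.mem_image.1 (Finset.mem_coe.1 hS)
      have hT := (hAfin.mem_toFinset).1 hTA
      exact ⟨⟨T, hT.1, rfl⟩, (hf T hT.1).capBlowup_mem hR hR1 hσ ha hb hT.2⟩
    have h3 : tubeCount σ 𝕌 x = A.card := by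
      rw [tubeCount, ← ncard_coe_finset, hA, Finite.coe_toFinset]
    have h4 : ((⌊Ceq + 1⌋₊ : ℕ) : ℝ) ≤ Ceq + 1 := Nat.floor_le (by linarith)
    calc tubeCount σ 𝕌 x ≤ (⌊Ceq + 1⌋₊ : ℝ) * (Finset.image f A).card := by
          rw [h3]; exact_mod_cast h1
      _ ≤ (Ceq + 1) * tubeCount s (f '' 𝕌) (capBlowup a b R x) := by
          rw [tubeCount]
          gcongr
  have hmeas := measurable_tubeCount s hSfin
  have hbound : tubeNorm s p (f '' 𝕌) ≤
      ENNReal.ofReal (A₀ * s ^ (1 - 3 / d) * m ^ (1 - β) * 4 ^ α) := by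
    refine hmain.trans (ENNReal.ofReal_le_ofReal ?_)
    have h := Real.rpow_le_rpow (by positivity) hgcard hα.le
    gcongr
  calc tubeNorm σ p 𝕌
      = eLpNorm (tubeCount σ 𝕌) (ENNReal.ofReal p) volume := tubeNorm_eq_eLpNorm hp _ _
    _ ≤ eLpNorm ((Ceq + 1) • fun x => tubeCount s (f '' 𝕌) (capBlowup a b R x))
          (ENNReal.ofReal p) volume := by
        refine eLpNorm_mono_real fun x => ?_
        rw [Real.norm_of_nonneg (show 0 ≤ tubeCount σ 𝕌 x from Nat.cast_nonneg _)]
        exact hcount x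
    _ = ENNReal.ofReal (Ceq + 1) * (ENNReal.ofReal (R ^ (2 / p)) * tubeNorm s p (f '' 𝕌)) := by
        rw [eLpNorm_const_smul, Real.enorm_eq_ofReal (by linarith),
          eLpNorm_comp_capBlowup hp a b hR hmeas, tubeNorm_eq_eLpNorm hp]
    _ ≤ ENNReal.ofReal (Ceq + 1) * (ENNReal.ofReal (R ^ (2 / p)) *
          ENNReal.ofReal (A₀ * s ^ (1 - 3 / d) * m ^ (1 - β) * 4 ^ α)) := by gcongr
    _ = _ := by
        rw [← ENNReal.ofReal_mul (by positivity), ← ENNReal.ofReal_mul (by linarith), ← mul_assoc]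

/-- The residue classes mod `N` of the cells of side `w` containing the coordinates of a tube. -/
def cellCode (N : ℕ) (w : ℝ) (T : Tube) : (ZMod N × ZMod N) × ZMod N × ZMod N :=
  ((⌊T.p0 0 / w⌋, ⌊T.p0 1 / w⌋), ⌊T.dir 0 / w⌋, ⌊T.dir 1 / w⌋)

lemma abs_sub_le_of_floor_eq_mod {N : ℕ} {w x y r : ℝ} (hw : 0 < w) (hr : r + w < N * w)
    (h : ((⌊x / w⌋ : ℤ) : ZMod N) = (⌊y / w⌋ : ℤ)) (hxy : |x - y| ≤ r) : |x - y| ≤ w := by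
  have hdvd := (ZMod.intCast_eq_intCast_iff_dvd_sub _ _ _).1 h
  have h1 := Int.floor_le (x / w)
  have h2 := Int.lt_floor_add_one (x / w)
  have h3 := Int.floor_le (y / w)
  have h4 := Int.lt_floor_add_one (y / w)
  have hq : |x / w - y / w| ≤ r / w := by
    rw [← sub_div, abs_div, abs_of_pos hw]; gcongr
  have hN : r / w + 1 < N := by
    rw [div_add_one hw.ne', div_lt_iff₀ hw]; exact hr
  have habs : |⌊y / w⌋ - ⌊x / w⌋| < (N : ℤ) := by
    have : |(⌊y / w⌋ : ℝ) - ⌊x / w⌋| < N := by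
      rw [abs_le] at hq
      rw [abs_lt]
      constructor <;> linarith
    exact_mod_cast this
  have h0 := Int.eq_zero_of_abs_lt_dvd hdvd habs
  have h5 : (⌊y / w⌋ : ℝ) = ⌊x / w⌋ := by exact_mod_cast sub_eq_zero.1 h0
  have h6 : |x / w - y / w| ≤ 1 := by
    rw [abs_le]; constructor <;> linarith
  rwa [← sub_div, abs_div, abs_of_pos hw, div_le_one hw] at h6

lemma CoordClose.of_cellCode_eq {N : ℕ} {w r : ℝ} {T T' : Tube} (hw : 0 < w)
    (hr : r + w < N * w) (h : cellCode N w T = cellCode N w T') (hc : CoordClose r T T') :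
    CoordClose w T T' := by
  simp only [cellCode, Prod.mk.injEq] at h
  exact ⟨⟨abs_sub_le_of_floor_eq_mod hw hr h.1.1 hc.1.1,
    abs_sub_le_of_floor_eq_mod hw hr h.1.2 hc.1.2⟩,
    abs_sub_le_of_floor_eq_mod hw hr h.2.1 hc.2.1, abs_sub_le_of_floor_eq_mod hw hr h.2.2 hc.2.2⟩

lemma EssDistinct.mono {C σ : ℝ} {𝕋 𝕌 : Set Tube} (h : EssDistinct C σ 𝕋) (hU : 𝕌 ⊆ 𝕋) :
    EssDistinct C σ 𝕌 := by
  refine ⟨h.1.subset hU, fun T hT => le_trans (Nat.cast_le.2 (ncard_le_ncard ?_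
    (h.1.subset fun _ h' => h'.1))) (h.2 T (hU hT))⟩
  exact fun _ h' => ⟨hU h'.1, h'.2⟩

lemma DirMultLE.mono {σ m : ℝ} {𝕋 𝕌 : Set Tube} (hfin : 𝕋.Finite) (h : DirMultLE σ 𝕋 m)
    (hU : 𝕌 ⊆ 𝕋) : DirMultLE σ 𝕌 m := by
  refine fun ω => le_trans (Nat.cast_le.2 (ncard_le_ncard ?_
    (hfin.subset fun _ h' => h'.1))) (h ω)
  exact fun _ h' => ⟨hU h'.1, h'.2⟩

lemma tubeNorm_empty {p : ℝ} (hp : 0 < p) (σ : ℝ) : tubeNorm σ p ∅ = 0 := by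
  have : tubeCount σ ∅ = 0 := by
    funext x
    simp [tubeCount]
  rw [tubeNorm_eq_eLpNorm hp, this, eLpNorm_zero]

/-- Minkowski's inequality for a partition of a collection of tubes. -/
lemma tubeNorm_le_sum_fibers {p : ℝ} (hp : 1 ≤ p) (σ : ℝ) {𝕋 : Set Tube} (hfin : 𝕋.Finite)
    {κ : Type*} [Fintype κ] (c : Tube → κ) :
    tubeNorm σ p 𝕋 ≤ ∑ k, tubeNorm σ p {T ∈ 𝕋 | c T = k} := by
  classical
  have hp0 : 0 < p := by linarith
  simp only [tubeNorm_eq_eLpNorm hp0]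
  have hsum : tubeCount σ 𝕋 = ∑ k, tubeCount σ {T ∈ 𝕋 | c T = k} := by
    funext x
    have hA : {T ∈ 𝕋 | x ∈ T.set σ}.Finite := hfin.subset fun _ h => h.1
    rw [Finset.sum_apply]
    simp only [tubeCount]
    rw [← Nat.cast_sum, ncard_eq_toFinset_card _ hA,
      Finset.card_eq_sum_card_fiberwise (f := c) (t := Finset.univ) (fun _ _ => by simp)]
    congr 1
    refine Finset.sum_congr rfl fun k _ => ?_
    rw [← ncard_coe_finset]
    congr 1
    ext T
    simp only [Finset.coe_filter, Finite.mem_toFinset, mem_ofPred_eq]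
    tauto
  rw [hsum]
  refine eLpNorm_sum_le (fun k _ => ?_) (by simpa using hp)
  exact (measurable_tubeCount σ (hfin.subset fun _ h => h.1)).aestronglyMeasurable

/-- For `C = 1` equivalence is equality of tubes, so that arbitrarily many nearly identical
parallel tubes are essentially distinct, and no X-ray estimate holds. -/
lemma not_xRayEstimate_one {d α β A₀ : ℝ} (hd2 : 2 < d) (hβ : 0 < β) (hA₀ : 0 < A₀) :
    ¬ XRayEstimate 1 d α β A₀ := by
  intro hX
  have hp : 0 < d / (d - 1) := div_pos (by linarith) (by linarith)
  set p := d / (d - 1)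
  let a : ℕ → ℝ := fun k => 1 / (8 * (k + 1))
  have ha0 : ∀ k, 0 < a k := fun k => by positivity
  have ha1 : ∀ k, a k ≤ 1 / 8 := fun k => by
    have : (0 : ℝ) ≤ k := k.cast_nonneg
    exact one_div_le_one_div_of_le (by norm_num) (by linarith)
  have hainj : Function.Injective a := fun k l h => by
    have h' : (8 * ((k : ℝ) + 1)) = 8 * (l + 1) := by simpa [a] using h
    have : (k : ℝ) = l := by linarith
    exact_mod_cast this
  let τ : ℕ → Tube := fun k => Tube.ofCoords (a k) 0 0 0 (by norm_num) (by norm_num)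
  have hτ0 : ∀ k, (τ k).p0 0 = a k := fun k => by simp [τ, Tube.ofCoords]
  have hτ1 : ∀ k, (τ k).p0 1 = 0 := fun k => by simp [τ, Tube.ofCoords]
  have hτd0 : ∀ k, (τ k).dir 0 = 0 := fun k => by simp [τ, Tube.ofCoords, Tube.dir]
  have hτd1 : ∀ k, (τ k).dir 1 = 0 := fun k => by simp [τ, Tube.ofCoords, Tube.dir]
  have hτinj : Function.Injective τ := fun k l h => hainj (by rw [← hτ0, h, hτ0])
  have hle : ∀ k l, (τ k).set (1 / 2) ⊆ (τ l).set (1 / 2) → a k ≤ a l := by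
    intro k l h
    by_contra! hlt
    have hmem : (τ k).p0 + EuclideanSpace.single 0 (1 / 2 - (a k - a l)) ∈ (τ k).set (1 / 2) := by
      refine ((τ k).mem_set_iff _ _).2 ⟨0, by simp, ?_⟩
      rw [zero_smul, add_zero, dist_self_add_left, PiLp.norm_single, Real.norm_eq_abs,
        abs_lt]
      constructor <;> linarith [ha1 k, ha0 l]
    obtain ⟨t, ht, hd⟩ := ((τ l).mem_set_iff _ _).1 (h hmem)
    have := (abs_apply_sub_le_dist _ _ 0).trans_lt hd
    simp only [PiLp.add_apply, PiLp.smul_apply, smul_eq_mul, hτ0, hτd0,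
      PiLp.single_apply, if_true] at this
    rw [abs_lt] at this
    linarith [this.2]
  let z : R3 := !₂[0, 0, 1 / 2]
  have hball : ∀ k, ball z (1 / 4) ⊆ (τ k).set (1 / 2) := by
    intro k x hx
    refine ((τ k).mem_set_iff _ _).2 ⟨1 / 2, by norm_num, ?_⟩
    have h1 : dist z ((τ k).p0 + (1 / 2 : ℝ) • (τ k).dir) ≤ 1 / 8 := by
      rw [dist_eq_norm]
      refine norm_le_of_sq (by norm_num) ?_
      simp only [PiLp.add_apply, PiLp.smul_apply, PiLp.sub_apply, smul_eq_mul, hτ0, hτ1, hτd0,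
        hτd1, (τ k).h0, (τ k).dir_two]
      simp [z]
      nlinarith [ha0 k, ha1 k]
    linarith [dist_triangle x z ((τ k).p0 + (1 / 2 : ℝ) • (τ k).dir), mem_ball.1 hx]
  have hvol0 : volume (ball z (1 / 4)) ≠ 0 := (measure_ball_pos _ _ (by norm_num)).ne'
  have hvol1 : volume (ball z (1 / 4)) ≠ ∞ := measure_ball_lt_top.ne
  set c : ℝ := ((volume (ball z (1 / 4))) ^ (1 / p)).toReal with hc
  have hctop : (volume (ball z (1 / 4))) ^ (1 / p) ≠ ∞ :=
    ENNReal.rpow_ne_top_of_nonneg (by positivity) hvol1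
  have hc0 : 0 < c := ENNReal.toReal_pos
    (ENNReal.rpow_pos (pos_iff_ne_zero.2 hvol0) hvol1).ne' hctop
  set K : ℝ := A₀ * (1 / 2) ^ (1 - 3 / d) * ((1 / 2) ^ 2 * (1 : ℕ)) ^ α with hK
  have hmain : ∀ n : ℕ, 0 < n → (n : ℝ) ^ β ≤ K / c := by
    intro n hn
    set 𝕋 : Set Tube := τ '' (Finset.range n : Set ℕ) with h𝕋
    have hfin : 𝕋.Finite := (Finset.finite_toSet _).image _
    have hcard : 𝕋.ncard = n := by
      rw [h𝕋, ncard_image_of_injective _ hτinj, ncard_coe_finset, Finset.card_range]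
    have hdist : EssDistinct 1 (1 / 2) 𝕋 := by
      refine ⟨hfin, ?_⟩
      rintro _ ⟨k, -, rfl⟩
      have : {T' ∈ 𝕋 | T' ≠ τ k ∧ TubeEquiv 1 (1 / 2) (τ k) T'} = ∅ := by
        rw [eq_empty_iff_forall_notMem]
        rintro _ ⟨⟨l, -, rfl⟩, hne, he⟩
        rw [TubeEquiv, one_mul] at he
        exact hne (by rw [hainj ((hle k l he.1).antisymm (hle l k he.2))])
      rw [this]
      simp
    have hdir : ∀ T ∈ 𝕋, T.dir ∈ ({!₂[0, 0, 1]} : Set R3) := by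
      rintro _ ⟨k, -, rfl⟩
      rw [mem_singleton_iff]
      ext i
      fin_cases i
      · simp [hτd0]
      · simp [hτd1]
      · simp [(τ k).dir_two]
    have hmult : DirMultLE (1 / 2) 𝕋 n := fun ω => by
      rw [← hcard]
      exact Nat.cast_le.2 (ncard_le_ncard (fun _ h => h.1) hfin)
    have h := hX (1 / 2) (by norm_num) (by norm_num) {!₂[0, 0, 1]}
      (by rintro v rfl; simp [IsDirection]) (by rintro x rfl y rfl h; exact (h rfl).elim)
      (finite_singleton _) 𝕋 hdist hdir n hmult
    have hlow : ENNReal.ofReal (n * c) ≤ tubeNorm (1 / 2) p 𝕋 := by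
      rw [ENNReal.ofReal_mul n.cast_nonneg, hc, ENNReal.ofReal_toReal hctop,
        tubeNorm_eq_eLpNorm hp]
      have h1 := eLpNorm_indicator_const (μ := (volume : Measure R3)) (p := ENNReal.ofReal p)
        (c := (n : ℝ)) (measurableSet_ball (x := z) (ε := 1 / 4)) (by simpa)
        ENNReal.ofReal_ne_top
      rw [ENNReal.toReal_ofReal hp.le, Real.enorm_eq_ofReal n.cast_nonneg] at h1
      rw [← h1]
      refine eLpNorm_mono_real fun x => ?_
      by_cases hx : x ∈ ball z (1 / 4)
      · have : {T ∈ 𝕋 | x ∈ T.set (1 / 2)} = 𝕋 := by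
          ext T
          simp only [mem_ofPred_eq, and_iff_left_iff_imp]
          rintro ⟨k, -, rfl⟩
          exact hball k hx
        rw [indicator_of_mem hx, tubeCount, this, hcard]
        simp
      · rw [indicator_of_notMem hx, norm_zero]
        exact Nat.cast_nonneg _
    rw [ncard_singleton] at h
    have hn0 : (0 : ℝ) < n := Nat.cast_pos.2 hn
    have h2 := (ENNReal.ofReal_le_ofReal_iff (by positivity)).1 (hlow.trans h)
    have h3 : (n : ℝ) * c ≤ K * (n : ℝ) ^ (1 - β) := by rw [hK]; linarith
    rw [Real.rpow_sub hn0, Real.rpow_one, mul_div_assoc', le_div_iff₀ (by positivity)] at h3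
    rw [le_div_iff₀ hc0]
    refine le_of_mul_le_mul_left ?_ hn0
    linarith
  have htend := (tendsto_rpow_atTop hβ).comp tendsto_natCast_atTop_atTop
  obtain ⟨n, hn, hn0⟩ := ((htend.eventually_gt_atTop (K / c)).and
    (Filter.eventually_gt_atTop 0)).exists
  exact absurd (hmain n hn0) (not_le.2 hn)

/-- Rescaled X-ray estimate (Lemma 2.4, second part): if an X-ray estimate holds at
dimension d ∈ (2,3) with exponents α, β and constant A₀, then there is a constant A
such that for all δ ≤ σ ≤ θ ≤ c₀ and every collection 𝕋 of essentially distinct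
σ-tubes whose directions lie in a cap of radius θ, one has
‖∑ χ_T‖_{d'} ≤ A σ^{(d-3)/d} θ^{(d+1)/d} m^{1-β}, with m the directional multiplicity. -/
theorem xray_rescaled (Ceq d α β A₀ : ℝ) (hCeq : 1 ≤ Ceq) (hd2 : 2 < d) (hd3 : d < 3)
    (hα : 0 < α) (hα1 : α < 1) (hβ : 0 < β) (hβ1 : β < 1) (hA₀ : 0 < A₀)
    (hX : XRayEstimate Ceq d α β A₀) :
    ∃ A c₀ : ℝ, 0 < A ∧ 0 < c₀ ∧
      ∀ δ σ θ : ℝ, 0 < δ → δ ≤ σ → σ ≤ θ → θ ≤ c₀ →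
        ∀ 𝕋 : Set Tube, EssDistinct Ceq σ 𝕋 →
          ∀ m : ℝ, DirMultLE σ 𝕋 m →
            (∃ ω : R3, ∀ T ∈ 𝕋, dist T.dir ω ≤ θ) →
            tubeNorm σ (d / (d - 1)) 𝕋 ≤
              ENNReal.ofReal (A * σ ^ ((d - 3) / d) * θ ^ ((d + 1) / d) * m ^ (1 - β)) := by
  have hC1 : 1 < Ceq := by
    refine lt_of_le_of_ne hCeq fun h => ?_
    subst h
    exact not_xRayEstimate_one hd2 hβ hA₀ hX
  have hd0 : 0 < d := by linarith
  have hp1 : 1 ≤ d / (d - 1) := by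
    rw [one_le_div (by linarith)]; linarith
  have hp : 0 < d / (d - 1) := by linarith
  obtain ⟨η, hη, hη2, hηC⟩ : ∃ η : ℝ, 0 < η ∧ η ≤ 1 / 2 ∧ 3 * η ≤ Ceq - 1 :=
    ⟨min (1 / 2) ((Ceq - 1) / 3), lt_min (by norm_num) (by linarith), min_le_left _ _, by
      linarith [min_le_right (1 / 2) ((Ceq - 1) / 3)]⟩
  obtain ⟨N, hN⟩ := exists_nat_gt (60 * Ceq / η + 1)
  have hN0 : N ≠ 0 := by
    rintro rfl
    have : 0 < 60 * Ceq / η + 1 := by positivity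
    simp at hN
    linarith
  have : NeZero N := ⟨hN0⟩
  have hNη : 60 * Ceq + η < N * η := by
    rwa [div_add_one hη.ne', div_lt_iff₀ hη] at hN
  have hNpos : (0 : ℝ) < N := by positivity
  refine ⟨N ^ 4 * (Ceq + 1) * 100 ^ (2 / (d / (d - 1))) * A₀ * (12 / 100) ^ (1 - 3 / d) * 4 ^ α,
    1 / 100, by positivity, by norm_num, ?_⟩
  intro δ σ θ hδ hδσ hσθ hθ 𝕋 h𝕋 m hm ⟨ω, hω⟩
  have hσ : 0 < σ := by linarith
  have hθ0 : 0 < θ := by linarith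
  rcases 𝕋.eq_empty_or_nonempty with rfl | ⟨T₀, hT₀⟩
  · rw [tubeNorm_empty hp]; exact zero_le
  have hωi : ∀ T ∈ 𝕋, ∀ i, |T.dir i - ω i| ≤ θ := fun T hT i =>
    (abs_apply_sub_le_dist _ _ i).trans (hω T hT)
  have hω0 : |ω 0| ≤ 1 / 5 := by
    have h1 := hωi T₀ hT₀ 0
    have h2 := T₀.abs_dir_zero_le
    rw [abs_le] at *
    constructor <;> linarith
  have hω1 : |ω 1| ≤ 1 / 5 := by
    have h1 := hωi T₀ hT₀ 1
    have h2 := T₀.abs_dir_one_le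
    rw [abs_le] at *
    constructor <;> linarith
  have hdiv : ∀ x : ℝ, |x| ≤ θ → |x / (100 * θ)| ≤ 1 / 100 := by
    intro x hx
    rw [abs_div, abs_of_pos (by positivity : 0 < 100 * θ), div_le_iff₀ (by positivity)]
    linarith
  have hw : 0 < η * σ := by positivity
  have hr : 60 * Ceq * σ + η * σ < N * (η * σ) := by nlinarith
  have hclass : ∀ k, tubeNorm σ (d / (d - 1)) {T ∈ 𝕋 | cellCode N (η * σ) T = k} ≤
      ENNReal.ofReal ((Ceq + 1) * (100 * θ) ^ (2 / (d / (d - 1))) *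
        (A₀ * (12 * σ / (100 * θ)) ^ (1 - 3 / d) * m ^ (1 - β) * 4 ^ α)) := by
    intro k
    have hsub : {T ∈ 𝕋 | cellCode N (η * σ) T = k} ⊆ 𝕋 := fun _ h => h.1
    refine tubeNorm_le_of_clustered (R := 100 * θ) (a := ω 0) (b := ω 1) hCeq hd2 hα hA₀ hX hη
      hη2 hηC hσ (by positivity) (by linarith) (by linarith) hω0 hω1 ?_ (h𝕋.mono hsub)
      (hm.mono h𝕋.1 hsub) ?_ ?_
    · exact fun T hT => ⟨hdiv _ (hωi T hT.1 0), hdiv _ (hωi T hT.1 1)⟩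
    · exact fun T hT T' hT' h => h.of_cellCode_eq hw hr (hT.2.trans hT'.2.symm)
    · intro T hT T' hT' h0 h1
      have hc := hT.2.trans hT'.2.symm
      simp only [cellCode, Prod.mk.injEq] at hc
      exact ⟨abs_sub_le_of_floor_eq_mod hw hr hc.2.1 h0,
        abs_sub_le_of_floor_eq_mod hw hr hc.2.2 h1⟩
  refine (tubeNorm_le_sum_fibers hp1 σ h𝕋.1 (cellCode N (η * σ))).trans ?_
  refine (Finset.sum_le_sum fun k _ => hclass k).trans (le_of_eq ?_)
  rw [Finset.sum_const, Finset.card_univ, nsmul_eq_mul, ← ENNReal.ofReal_natCast,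
    ← ENNReal.ofReal_mul (Nat.cast_nonneg _)]
  congr 1
  have e1 : (12 * σ / (100 * θ)) ^ (1 - 3 / d)
      = (12 / 100) ^ (1 - 3 / d) * σ ^ ((d - 3) / d) * θ ^ (-((d - 3) / d)) := by
    rw [show 12 * σ / (100 * θ) = 12 / 100 * σ * θ⁻¹ by field_simp,
      Real.mul_rpow (by positivity) (by positivity), Real.mul_rpow (by positivity) hσ.le,
      Real.inv_rpow hθ0.le, ← Real.rpow_neg hθ0.le, show 1 - 3 / d = (d - 3) / d by field_simp]
  have e2 : θ ^ ((d + 1) / d) = θ ^ (2 / (d / (d - 1))) * θ ^ (-((d - 3) / d)) := by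
    rw [← Real.rpow_add hθ0]
    congr 1
    have : d - 1 ≠ 0 := by linarith
    field_simp
    ring
  rw [e1, e2, Real.mul_rpow (by norm_num) hθ0.le]
  simp only [Fintype.card_prod, ZMod.card]
  push_cast
  ring

end
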